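/- Let ι_2(a_1, a_2) be the number of solutions in nonnegative integers (x_1,x_2,x_3,x_4,x_5,x_6) of x_1 + x_2 + x_5 + x_6 = a_1 and x_3 + x_4 + x_5 + x_6 = a_2 (each of e_1*, e_2*, e_1*+e_2* taken with multiplicity 2). Then for all integers a_1 ≥ a_2 ≥ 0, ι_2(a_1,a_2) = (1/2)·binom(a_2+3, 3)·(2a_1 - a_2 + 2). -/

import Mathlib

theorem sum_range_succ_mul_sub_mul_sub (A B : ℚ) (n : ℕ) :
    ∑ s ∈ Finset.range n, ((s : ℚ) + 1) * ((A - s) * (B - s)) =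
      n * (n + 1) * (A * B / 2 - (A + B) * (n - 1) / 3 + (n - 2) * (n - 1) / 4 + (n - 1) / 3) := by
  induction n with
  | zero => simp
  | succ k ih =>
    rw [Finset.sum_range_succ, ih]
    push_cast
    ring

/-- A solution is determined by `x 4 + x 5`, `x 4`, `x 0` and `x 2`. -/
def solutionsEquiv (a₁ a₂ : ℕ) (h : a₂ ≤ a₁) :
    {x : Fin 6 → ℕ // x 0 + x 1 + x 4 + x 5 = a₁ ∧ x 2 + x 3 + x 4 + x 5 = a₂} ≃
      {p : (_ : ℕ) × ℕ × ℕ × ℕ // p ∈ (Finset.range (a₂ + 1)).sigma fun s =>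
        Finset.range (s + 1) ×ˢ Finset.range (a₁ + 1 - s) ×ˢ Finset.range (a₂ + 1 - s)} where
  toFun x := ⟨⟨x.1 4 + x.1 5, x.1 4, x.1 0, x.1 2⟩, by
    have hx := x.2
    simp only [Finset.mem_sigma, Finset.mem_product, Finset.mem_range]
    omega⟩
  invFun p := ⟨![p.1.2.2.1, a₁ - p.1.1 - p.1.2.2.1, p.1.2.2.2, a₂ - p.1.1 - p.1.2.2.2,
      p.1.2.1, p.1.1 - p.1.2.1], by
    have hp := p.2
    simp only [Finset.mem_sigma, Finset.mem_product, Finset.mem_range] at hp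
    simp
    omega⟩
  left_inv x := by
    obtain ⟨x, h₁, h₂⟩ := x
    ext i
    fin_cases i <;> simp <;> omega
  right_inv p := by
    obtain ⟨⟨s, u, v, w⟩, hp⟩ := p
    simp only [Finset.mem_sigma, Finset.mem_product, Finset.mem_range] at hp
    simp
    omega

theorem stmt12 (a₁ a₂ : ℕ) (h : a₂ ≤ a₁) :
    (Nat.card {x : Fin 6 → ℕ //
        x 0 + x 1 + x 4 + x 5 = a₁ ∧ x 2 + x 3 + x 4 + x 5 = a₂} : ℚ) =
      (1 / 2) * ((a₂ + 3).choose 3 : ℚ) * (2 * (a₁ : ℚ) - a₂ + 2) := by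
  have hsum : ∑ s ∈ Finset.range (a₂ + 1), (((s + 1) * ((a₁ + 1 - s) * (a₂ + 1 - s)) : ℕ) : ℚ) =
      ∑ s ∈ Finset.range (a₂ + 1), ((s : ℚ) + 1) * (((a₁ + 1 : ℚ) - s) * ((a₂ + 1 : ℚ) - s)) := by
    refine Finset.sum_congr rfl fun s hs => ?_
    rw [Finset.mem_range] at hs
    push_cast [Nat.cast_sub (show s ≤ a₁ + 1 by omega), Nat.cast_sub (show s ≤ a₂ + 1 by omega)]
    rfl
  have hchoose : ((a₂ + 3).choose 3 : ℚ) = (a₂ + 1) * (a₂ + 2) * (a₂ + 3) / 6 := by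
    rw [Nat.cast_choose_eq_ascPochhammer_div]
    simp [ascPochhammer_succ_eval, Nat.factorial]
    ring
  rw [Nat.card_congr (solutionsEquiv a₁ a₂ h), Nat.card_eq_fintype_card, Fintype.card_coe,
    Finset.card_sigma]
  simp only [Finset.card_product, Finset.card_range]
  rw [Nat.cast_sum, hsum, sum_range_succ_mul_sub_mul_sub, hchoose]
  push_cast
  ring
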